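/- arXiv:1906.04066 — 2 statements merged into one kernel-verified Lean document; each statement's English description precedes it below -/
import Mathlib

section
/- Let B > 0 and c > 0 be constants. There exist constants c' > 0, d₀ and k₀, depending only on B and c, such that the following deterministic implication holds for all d ≥ d₀ and k ≥ k₀. Suppose θ* ∈ ℝ^d satisfies ‖θ*‖_∞ ≤ B and Σ_i θ*_i = 0; suppose μ_mi ∈ [0,1] for m ≠ i satisfy μ_mi + μ_im = 1; suppose θ̂ ∈ ℝ^d satisfies Σ_i θ̂_i = 0 and the first-order optimality condition Σ_{i ≠ m} σ(θ̂_m − θ̂_i) = Σ_{i ≠ m} μ_mi for every m ∈ {1,...,d}; and suppose |Σ_{i ≠ m} μ_mi − Σ_{i ≠ m} σ(θ*_m − θ*_i)| ≤ c·√(d·(log d + log k)/k) for every m. Then ‖θ̂ − θ*‖_∞ ≤ c'·√((log d + log k)/(d·k)). -/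
open Finset

/-- The sigmoid (logistic) function `σ(x) = 1/(1+e^{-x})`. -/
noncomputable def sigmoid (x : ℝ) : ℝ := 1 / (1 + Real.exp (-x))

lemma sigmoid_monotone : Monotone sigmoid := by
  intro x y h
  unfold sigmoid
  gcongr

lemma sigmoid_neg (x : ℝ) : sigmoid (-x) = 1 - sigmoid x := by
  unfold sigmoid
  have h : Real.exp x ≠ 0 := (Real.exp_pos x).ne'
  have h' : 1 + Real.exp x ≠ 0 := by positivity
  rw [neg_neg, Real.exp_neg]
  field_simp
  ring

/-- A lower bound for the slope of the sigmoid on unit intervals starting in `[-b, b]`. -/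
noncomputable def sigmoidSlope (b : ℝ) : ℝ := Real.exp (-b) / (2 * (1 + Real.exp b) ^ 2)

lemma sigmoidSlope_pos (b : ℝ) : 0 < sigmoidSlope b := by
  unfold sigmoidSlope
  positivity

lemma half_le_one_sub_exp_neg {s : ℝ} (h0 : 0 ≤ s) (h1 : s ≤ 1) :
    s / 2 ≤ 1 - Real.exp (-s) := by
  have h2 : (1 + s) * Real.exp (-s) ≤ 1 := by
    calc (1 + s) * Real.exp (-s) ≤ Real.exp s * Real.exp (-s) := by
          gcongr
          linarith [Real.add_one_le_exp s]
      _ = 1 := by rw [← Real.exp_add]; simp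
  nlinarith [Real.exp_pos (-s)]

lemma sigmoidSlope_mul_min_le {b a t : ℝ} (ha : |a| ≤ b) (ht : 0 ≤ t) :
    sigmoidSlope b * min t 1 ≤ sigmoid (a + t) - sigmoid a := by
  obtain ⟨hl, hu⟩ := abs_le.1 ha
  set s := min t 1 with hs
  have hs0 : 0 ≤ s := le_min ht zero_le_one
  have hmono : sigmoid (a + s) ≤ sigmoid (a + t) :=
    sigmoid_monotone (by linarith [min_le_left t 1])
  have hdiff : sigmoid (a + s) - sigmoid a =
      Real.exp (-a) * (1 - Real.exp (-s)) / ((1 + Real.exp (-(a + s))) * (1 + Real.exp (-a))) := by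
    unfold sigmoid
    have h1 : 1 + Real.exp (-(a + s)) ≠ 0 := by positivity
    have h2 : 1 + Real.exp (-a) ≠ 0 := by positivity
    rw [div_sub_div _ _ h1 h2, neg_add, Real.exp_add]
    ring
  have hhalf := half_le_one_sub_exp_neg hs0 (min_le_right t 1)
  have hden : (1 + Real.exp (-(a + s))) * (1 + Real.exp (-a)) ≤ (1 + Real.exp b) ^ 2 := by
    rw [sq]
    gcongr <;> linarith
  calc sigmoidSlope b * s = Real.exp (-b) * (s / 2) / (1 + Real.exp b) ^ 2 := by
        unfold sigmoidSlope
        field_simp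
    _ ≤ Real.exp (-a) * (1 - Real.exp (-s)) /
          ((1 + Real.exp (-(a + s))) * (1 + Real.exp (-a))) := by
        gcongr
        exact mul_nonneg (Real.exp_pos _).le (by linarith)
    _ ≤ sigmoid (a + t) - sigmoid a := by linarith

lemma sigmoidSlope_mul_min_le_sub {b a t : ℝ} (ha : |a| ≤ b) (ht : 0 ≤ t) :
    sigmoidSlope b * min t 1 ≤ sigmoid a - sigmoid (a - t) := by
  have h := sigmoidSlope_mul_min_le ((abs_neg a).trans_le ha) ht
  rw [show -a + t = -(a - t) by ring, sigmoid_neg, sigmoid_neg] at h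
  linarith

lemma min_add_one_le {a b : ℝ} (ha : 0 ≤ a) (hb : 0 ≤ b) :
    min (a + b) 1 ≤ min a 1 + min b 1 := by
  grind

/-- The spread of `x - y` is controlled by the deviations of the sigmoid row sums of `x`
from those of `y`. -/
lemma sigmoidSlope_mul_min_spread_le {d : ℕ} {B r : ℝ} {x y : Fin d → ℝ} (hy : ‖y‖ ≤ B)
    (hr : ∀ m, |∑ i ∈ univ.erase m, sigmoid (x m - x i) -
      ∑ i ∈ univ.erase m, sigmoid (y m - y i)| ≤ r)
    {p q : Fin d} (hp : ∀ i, (x - y) i ≤ (x - y) p) (hq : ∀ i, (x - y) q ≤ (x - y) i) :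
    d * (sigmoidSlope (2 * B) * min ((x - y) p - (x - y) q) 1) ≤ 2 * r := by
  have hy' : ∀ m i, |y m - y i| ≤ 2 * B := fun m i => by
    have h1 := (norm_le_pi_norm y m).trans hy
    have h2 := (norm_le_pi_norm y i).trans hy
    rw [Real.norm_eq_abs] at h1 h2
    linarith [abs_sub (y m) (y i)]
  have hfull : ∀ m, ∑ i ∈ univ.erase m, sigmoid (x m - x i) -
      ∑ i ∈ univ.erase m, sigmoid (y m - y i) =
        ∑ i, (sigmoid (x m - x i) - sigmoid (y m - y i)) := fun m => by
    rw [← sum_sub_distrib]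
    exact sum_erase _ (by simp)
  have hP := (abs_le.1 (hr p)).2
  have hQ := (abs_le.1 (hr q)).1
  rw [hfull] at hP hQ
  have hsum : ∑ _i : Fin d, sigmoidSlope (2 * B) * min ((x - y) p - (x - y) q) 1 ≤
      ∑ i, ((sigmoid (x p - x i) - sigmoid (y p - y i)) -
        (sigmoid (x q - x i) - sigmoid (y q - y i))) := by
    refine sum_le_sum fun i _ => ?_
    have hpi : 0 ≤ (x - y) p - (x - y) i := sub_nonneg.2 (hp i)
    have hqi : 0 ≤ (x - y) i - (x - y) q := sub_nonneg.2 (hq i)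
    have h1 := sigmoidSlope_mul_min_le (hy' p i) hpi
    have h2 := sigmoidSlope_mul_min_le_sub (hy' q i) hqi
    have h3 := mul_le_mul_of_nonneg_left (min_add_one_le hpi hqi) (sigmoidSlope_pos (2 * B)).le
    simp only [Pi.sub_apply] at h1 h2 h3 ⊢
    rw [show y p - y i + (x p - y p - (x i - y i)) = x p - x i by ring] at h1
    rw [show y q - y i - (x i - y i - (x q - y q)) = x q - x i by ring] at h2
    rw [show x p - y p - (x i - y i) + (x i - y i - (x q - y q)) =
      x p - y p - (x q - y q) by ring] at h3
    linarith
  rw [sum_sub_distrib, sum_const, card_univ, Fintype.card_fin, nsmul_eq_mul] at hsum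
  linarith

lemma norm_le_spread_of_sum_eq_zero {d : ℕ} {z : Fin d → ℝ} (hz : ∑ i, z i = 0) {p q : Fin d}
    (hp : ∀ i, z i ≤ z p) (hq : ∀ i, z q ≤ z i) : ‖z‖ ≤ z p - z q := by
  have hp0 : 0 ≤ z p := by
    by_contra! h
    exact (sum_neg (fun i _ => (hp i).trans_lt h) ⟨p, mem_univ p⟩).ne hz
  have hq0 : z q ≤ 0 := by
    by_contra! h
    exact (sum_pos (fun i _ => h.trans_le (hq i)) ⟨q, mem_univ q⟩).ne' hz
  refine (pi_norm_le_iff_of_nonneg (by linarith)).2 fun i => ?_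
  rw [Real.norm_eq_abs, abs_le]
  constructor <;> linarith [hp i, hq i]

lemma log_add_log_div_mul_le {d k : ℝ} (hd : 1 ≤ d) (hk : 1 ≤ k) :
    (Real.log d + Real.log k) / (d * k) ≤ 3 / √k := by
  have hk0 : 0 < k := by linarith
  have hs : 1 ≤ √k := Real.one_le_sqrt.2 hk
  have hsq : √k * √k = k := Real.mul_self_sqrt hk0.le
  have h1 : Real.log d ≤ d := Real.log_le_self (by linarith)
  have h2 : Real.log k ≤ 2 * √k := by
    have := Real.log_le_self (Real.sqrt_nonneg k)
    rw [Real.log_sqrt hk0.le] at this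
    linarith
  rw [div_le_div_iff₀ (by positivity) (by positivity)]
  calc (Real.log d + Real.log k) * √k ≤ (d * √k + d * (2 * √k)) * √k := by
        gcongr
        · nlinarith
        · nlinarith
    _ = 3 * (d * (√k * √k)) := by ring
    _ = 3 * (d * k) := by rw [hsq]

/-- Lemma 5: a deterministic `ℓ_∞` bound. If `θ*` is centered
with `‖θ*‖_∞ ≤ B`, the data `μ` are valid win fractions, `θ̂` is centered and
satisfies the first-order optimality condition of the unconstrained MLE, and the
row sums of `μ` concentrate at rate `c √(d(log d + log k)/k)`, then
`‖θ̂ − θ*‖_∞ ≤ c' √((log d + log k)/(dk))` for all `d ≥ d₀`, `k ≥ k₀`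
(the norm on `Fin d → ℝ` is the sup norm). -/
theorem unconstrained_mle_linfty_bound (B c : ℝ) (hB : 0 < B) (hc : 0 < c) :
    ∃ c' > (0 : ℝ), ∃ d₀ k₀ : ℕ, ∀ d k : ℕ, d₀ ≤ d → k₀ ≤ k →
      ∀ θstar θhat : Fin d → ℝ, ∀ μ : Fin d → Fin d → ℝ,
        ‖θstar‖ ≤ B → (∑ i, θstar i = 0) →
        (∀ m i : Fin d, m ≠ i → (0 ≤ μ m i ∧ μ m i ≤ 1) ∧ μ m i + μ i m = 1) →
        (∑ i, θhat i = 0) →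
        (∀ m : Fin d,
          ∑ i ∈ Finset.univ.erase m, sigmoid (θhat m - θhat i) =
            ∑ i ∈ Finset.univ.erase m, μ m i) →
        (∀ m : Fin d,
          |(∑ i ∈ Finset.univ.erase m, μ m i) -
              ∑ i ∈ Finset.univ.erase m, sigmoid (θstar m - θstar i)| ≤
            c * Real.sqrt ((d : ℝ) * (Real.log d + Real.log k) / k)) →
        ‖θhat - θstar‖ ≤ c' * Real.sqrt ((Real.log d + Real.log k) / ((d : ℝ) * k)) := by
  set κ := sigmoidSlope (2 * B) with hκ
  have hκ0 : 0 < κ := sigmoidSlope_pos _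
  set δ := κ / (2 * c) with hδ
  have hδ0 : 0 < δ := by positivity
  obtain ⟨N, hN⟩ := exists_nat_gt ((3 / δ ^ 2) ^ 2)
  refine ⟨2 * c / κ, by positivity, 1, N + 1, ?_⟩
  intro d k hd hk θstar θhat μ hB' hsum _ hsum' hopt hdev
  have hd1 : (1 : ℝ) ≤ d := by exact_mod_cast hd
  have hk1 : (1 : ℝ) ≤ k := by exact_mod_cast (by omega : 1 ≤ k)
  have hNk : (N : ℝ) ≤ k := by exact_mod_cast (by omega : N ≤ k)
  set ε := √((Real.log d + Real.log k) / ((d : ℝ) * k)) with hε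
  have hscale : √((d : ℝ) * (Real.log d + Real.log k) / k) = d * ε := by
    rw [show (d : ℝ) * (Real.log d + Real.log k) / k =
      d ^ 2 * ((Real.log d + Real.log k) / (d * k)) by field_simp,
      Real.sqrt_mul (by positivity), Real.sqrt_sq (by positivity)]
  have hεδ : ε < δ := by
    rw [hε, Real.sqrt_lt' hδ0]
    refine (log_add_log_div_mul_le hd1 hk1).trans_lt ?_
    have h : 3 / δ ^ 2 < √k := Real.lt_sqrt_of_sq_lt (by linarith)
    rw [div_lt_iff₀ (by positivity)] at h ⊢
    linarith
  have : Nonempty (Fin d) := ⟨⟨0, hd⟩⟩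
  obtain ⟨p, hp⟩ := Finite.exists_max (θhat - θstar)
  obtain ⟨q, hq⟩ := Finite.exists_min (θhat - θstar)
  have hspread := sigmoidSlope_mul_min_spread_le hB'
    (fun m => by rw [hopt m]; exact hdev m) hp hq
  rw [hscale, ← hκ] at hspread
  have hmin : min ((θhat - θstar) p - (θhat - θstar) q) 1 ≤ 2 * c / κ * ε := by
    rw [div_mul_eq_mul_div, le_div_iff₀ hκ0]
    refine le_of_mul_le_mul_left ?_ (by linarith : (0 : ℝ) < d)
    linarith
  have hlt : 2 * c / κ * ε < 1 := by
    calc 2 * c / κ * ε < 2 * c / κ * δ := by gcongr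
      _ = 1 := by rw [hδ]; field_simp
  have hzero : ∑ i, (θhat - θstar) i = 0 := by
    simp [sum_sub_distrib, hsum, hsum']
  refine (norm_le_spread_of_sum_eq_zero hzero hp hq).trans ?_
  exact (min_le_iff.1 hmin).resolve_right (not_le.2 hlt)
end

section
/- Let d ≥ 1, let Δ ∈ ℝ^d satisfy Σ_{i=1}^d Δ_i = 0, let c₃ > 0 and ε ≥ 0, and let w_{m,i} (for m, i ∈ {1,...,d}) be real numbers with w_{m,i} ≥ c₃ for all m, i. Suppose that |Σ_{i=1}^d w_{m,i}·(Δ_m − Δ_i)| ≤ ε for every m ∈ {1,...,d}. Then max_m Δ_m − min_m Δ_m ≤ 2ε/(c₃·d), and consequently ‖Δ‖_∞ = max_m |Δ_m| ≤ 2ε/(c₃·d). -/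
open Finset

/-- At a maximizer `m` of a vector with zero sum, a weighted sum of the gaps `x m - x i` with weights
at least `c` is at least `c * card ι * x m`. -/
theorem mul_card_mul_le_sum_weighted_gap {ι : Type*} [Fintype ι] {x v : ι → ℝ} {c : ℝ} {m : ι}
    (hsum : ∑ i, x i = 0) (hv : ∀ i, c ≤ v i) (hm : ∀ i, x i ≤ x m) :
    c * Fintype.card ι * x m ≤ ∑ i, v i * (x m - x i) :=
  calc c * Fintype.card ι * x m = ∑ i, c * (x m - x i) := by
        rw [← Finset.mul_sum, Finset.sum_sub_distrib, hsum]
        simp [mul_assoc]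
    _ ≤ ∑ i, v i * (x m - x i) :=
        Finset.sum_le_sum fun i _ => mul_le_mul_of_nonneg_right (hv i) (sub_nonneg.mpr (hm i))

/-- core deterministic step of Lemma 7: if `Δ ∈ ℝ^d` sums to
zero, the weights satisfy `w_{m,i} ≥ c₃ > 0`, and
`|∑_i w_{m,i}(Δ_m − Δ_i)| ≤ ε` for every `m`, then
`max_m Δ_m − min_m Δ_m ≤ 2ε/(c₃ d)` and hence `|Δ_m| ≤ 2ε/(c₃ d)` for all `m`. -/
theorem weighted_gap_bound (d : ℕ) (hd : 1 ≤ d) (Δ : Fin d → ℝ)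
    (hsum : ∑ i, Δ i = 0) (c₃ ε : ℝ) (hc₃ : 0 < c₃) (hε : 0 ≤ ε)
    (w : Fin d → Fin d → ℝ) (hw : ∀ m i : Fin d, c₃ ≤ w m i)
    (h : ∀ m : Fin d, |∑ i, w m i * (Δ m - Δ i)| ≤ ε) :
    Finset.univ.sup' (Finset.univ_nonempty_iff.mpr ⟨⟨0, hd⟩⟩) Δ -
        Finset.univ.inf' (Finset.univ_nonempty_iff.mpr ⟨⟨0, hd⟩⟩) Δ ≤
      2 * ε / (c₃ * d) ∧
    ∀ m : Fin d, |Δ m| ≤ 2 * ε / (c₃ * d) := by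
  have hne : (Finset.univ : Finset (Fin d)).Nonempty := Finset.univ_nonempty_iff.mpr ⟨⟨0, hd⟩⟩
  have hcd : 0 < c₃ * d := mul_pos hc₃ (by exact_mod_cast hd)
  have upper : ∀ i, Δ i ≤ ε / (c₃ * d) := by
    obtain ⟨m, -, hm⟩ := Finset.exists_max_image Finset.univ Δ hne
    have key := mul_card_mul_le_sum_weighted_gap hsum (hw m) fun i => hm i (Finset.mem_univ i)
    rw [Fintype.card_fin] at key
    intro i
    refine (hm i (Finset.mem_univ i)).trans ((le_div_iff₀' hcd).mpr ?_)
    exact key.trans ((le_abs_self _).trans (h m))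
  have lower : ∀ i, -(ε / (c₃ * d)) ≤ Δ i := by
    obtain ⟨m, -, hm⟩ := Finset.exists_min_image Finset.univ Δ hne
    have key := mul_card_mul_le_sum_weighted_gap (x := fun i => -Δ i) (by simp [hsum]) (hw m)
      fun i => neg_le_neg (hm i (Finset.mem_univ i))
    have hflip : ∑ i, w m i * (-Δ m - -Δ i) = -∑ i, w m i * (Δ m - Δ i) := by
      rw [← Finset.sum_neg_distrib]
      exact Finset.sum_congr rfl fun i _ => by ring
    rw [Fintype.card_fin, hflip] at key
    intro i
    refine neg_le.mp ((neg_le_neg (hm i (Finset.mem_univ i))).trans ((le_div_iff₀' hcd).mpr ?_))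
    exact key.trans ((neg_le_abs _).trans (h m))
  have hnonneg : 0 ≤ ε / (c₃ * d) := div_nonneg hε hcd.le
  rw [mul_div_assoc]
  refine ⟨?_, fun m => abs_le.mpr ⟨by linarith [lower m], by linarith [upper m]⟩⟩
  have hsup := Finset.sup'_le hne Δ fun i _ => upper i
  have hinf := Finset.le_inf' hne Δ fun i _ => lower i
  linarith
end
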